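/- For the cyclic cubic Kummer extension k/k₀, the group 𝒫_k^G/𝒫_{k₀} of primitive ambiguous principal ideals of k with respect to k₀ has order exactly 3^{U+1} = 3 · (E_{k₀} : N_{k/k₀}(E_k)); moreover its order also equals 3^{A+R}, i.e. #(𝒫_k^G/𝒫_{k₀}) = #(𝒫_L^G/𝒫_ℚ) · #(ker of the map 𝒫_k^G/𝒫_{k₀} → 𝓘_L^G/𝓘_ℚ induced by N_{k/L}). -/

import Mathlib

open IntermediateField NumberField
open scoped nonZeroDivisors

set_option synthInstance.maxHeartbeats 1000000
set_option maxHeartbeats 2000000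

noncomputable section

instance : Fact (Nat.Prime 3) := ⟨by norm_num⟩

/-- A positive integer is cube-free if no prime cube divides it. -/
def IsCubeFree (d : ℕ) : Prop := ∀ p : ℕ, p.Prime → ¬ (p ^ 3 ∣ d)

/-- The primitive cube root of unity `ζ₃ = e^{2πi/3}`. -/
def zeta3 : ℂ := Complex.exp (2 * Real.pi * Complex.I / 3)

lemma zeta3_isPrimitiveRoot : IsPrimitiveRoot zeta3 3 := by
  simpa [zeta3] using Complex.isPrimitiveRoot_exp 3 (by norm_num)

lemma isIntegral_zeta3 : IsIntegral ℚ zeta3 :=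
  (zeta3_isPrimitiveRoot.isIntegral (by norm_num)).tower_top

/-- The real cube root of `d`, as a complex number. -/
def cbrt (d : ℕ) : ℂ := ((d : ℝ) ^ ((3 : ℝ)⁻¹) : ℝ)

lemma cbrt_pow_three (d : ℕ) : (cbrt d) ^ 3 = (d : ℂ) := by
  have h : ((d : ℝ) ^ ((3 : ℝ)⁻¹)) ^ (3 : ℕ) = (d : ℝ) := by
    rw [← Real.rpow_natCast ((d : ℝ) ^ ((3 : ℝ)⁻¹)) 3, ← Real.rpow_mul (by positivity)]
    norm_num
  calc (cbrt d) ^ 3 = (((((d : ℝ) ^ ((3 : ℝ)⁻¹)) ^ (3:ℕ) : ℝ)) : ℂ) := by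
        push_cast [cbrt]; ring
    _ = ((d : ℝ) : ℂ) := by rw [h]
    _ = (d : ℂ) := by norm_num

lemma isIntegral_cbrt (d : ℕ) : IsIntegral ℚ (cbrt d) := by
  have h : IsIntegral ℤ (cbrt d) := by
    refine ⟨Polynomial.X ^ 3 - Polynomial.C (d : ℤ), ?_, ?_⟩
    · exact Polynomial.monic_X_pow_sub_C _ (by norm_num)
    · simp [Polynomial.eval₂, cbrt_pow_three d]
  exact h.tower_top

/-- `k = ℚ(∛d, ζ₃)`, the normal closure of the pure cubic field `ℚ(∛d)`,
realized as a subfield of `ℂ`. -/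
def Kc (d : ℕ) : IntermediateField ℚ ℂ := ℚ⟮cbrt d, zeta3⟯

instance (d : ℕ) : NumberField (Kc d) where
  to_finiteDimensional := by
    apply IntermediateField.finiteDimensional_adjoin
    rintro x (rfl | rfl)
    · exact isIntegral_cbrt d
    · exact isIntegral_zeta3

lemma zeta3_mem (d : ℕ) : zeta3 ∈ Kc d :=
  IntermediateField.subset_adjoin _ _ (by simp)

lemma cbrt_mem (d : ℕ) : cbrt d ∈ Kc d :=
  IntermediateField.subset_adjoin _ _ (by simp)

/-- `ζ₃` as an element of `k`. -/
def zetaK (d : ℕ) : Kc d := ⟨zeta3, zeta3_mem d⟩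

/-- `∛d` as an element of `k`. -/
def cbrtK (d : ℕ) : Kc d := ⟨cbrt d, cbrt_mem d⟩

/-- `k₀ = ℚ(ζ₃)` realized as a subfield of `k`. -/
def k0S (d : ℕ) : IntermediateField ℚ (Kc d) := ℚ⟮zetaK d⟯

/-- `L = ℚ(∛d)` realized as a subfield of `k`. -/
def LS (d : ℕ) : IntermediateField ℚ (Kc d) := ℚ⟮cbrtK d⟯

instance (d : ℕ) : NumberField ↥(k0S d) where
instance (d : ℕ) : NumberField ↥(LS d) where

/-- `ζ₃` as an element of `k₀ ⊆ k`. -/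
def zetaK0 (d : ℕ) : ↥(k0S d) := ⟨zetaK d, IntermediateField.mem_adjoin_simple_self ℚ (zetaK d)⟩

/-- `∛d` as an element of `L ⊆ k`. -/
def cbrtL (d : ℕ) : ↥(LS d) := ⟨cbrtK d, IntermediateField.mem_adjoin_simple_self ℚ (cbrtK d)⟩

-- Shortcut instances (these hold by instance search; they are registered to speed up
-- elaboration).
instance (priority := 10000) (d : ℕ) : IsDedekindDomain (𝓞 ↥(Kc d)) := inferInstance
instance (priority := 10000) (d : ℕ) : IsDedekindDomain (𝓞 ↥(LS d)) := inferInstance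
instance (priority := 10000) (d : ℕ) : Algebra (𝓞 ↥(Kc d)) ↥(Kc d) := inferInstance
instance (priority := 10000) (d : ℕ) : Algebra (𝓞 ↥(LS d)) ↥(LS d) := inferInstance
instance (priority := 10000) (d : ℕ) : Module (𝓞 ↥(Kc d)) ↥(Kc d) := Algebra.toModule
instance (priority := 10000) (d : ℕ) : Module (𝓞 ↥(LS d)) ↥(LS d) := Algebra.toModule
instance (priority := 10000) (d : ℕ) : IsFractionRing (𝓞 ↥(Kc d)) ↥(Kc d) := inferInstance
instance (priority := 10000) (d : ℕ) : IsFractionRing (𝓞 ↥(LS d)) ↥(LS d) := inferInstance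
instance (priority := 10000) (d : ℕ) : Algebra ↥(k0S d) ↥(Kc d) := inferInstance
instance (priority := 10000) (d : ℕ) : Algebra ↥(LS d) ↥(Kc d) := inferInstance
instance (priority := 10000) (d : ℕ) :
    CommGroup ((FractionalIdeal (𝓞 ↥(Kc d))⁰ ↥(Kc d))ˣ) := inferInstance
instance (priority := 10000) (d : ℕ) :
    CommGroup ((FractionalIdeal (𝓞 ↥(LS d))⁰ ↥(LS d))ˣ) := inferInstance

/-- The subgroup `N_{k/k₀}(E_k)` of `E_{k₀}` consisting of relative norms of units of `k`. -/
def unitNormSubgroup (d : ℕ) : Subgroup ((𝓞 ↥(k0S d))ˣ) :=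
  Subgroup.closure
    {u | ∃ v : (𝓞 ↥(Kc d))ˣ,
      Algebra.norm ↥(k0S d) ((v : 𝓞 ↥(Kc d)) : ↥(Kc d)) = ((u : 𝓞 ↥(k0S d)) : ↥(k0S d))}

/-- The unit norm index `(E_{k₀} : N_{k/k₀}(E_k))`. -/
def unitNormIndex (d : ℕ) : ℕ := (unitNormSubgroup d).index

/-- `𝒫_k^G`: the group of `σ`-invariant (ambiguous) principal fractional ideals of `k`. -/
def ambPrincipalK (d : ℕ) (σ : ↥(Kc d) ≃ₐ[ℚ] ↥(Kc d)) :
    Subgroup ((FractionalIdeal (𝓞 ↥(Kc d))⁰ ↥(Kc d))ˣ) :=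
  Subgroup.closure
    {I | ∃ x : (↥(Kc d))ˣ, I = toPrincipalIdeal (𝓞 ↥(Kc d)) ↥(Kc d) x ∧
      FractionalIdeal.spanSingleton (𝓞 ↥(Kc d))⁰ (σ (x : ↥(Kc d))) =
        FractionalIdeal.spanSingleton (𝓞 ↥(Kc d))⁰ (x : ↥(Kc d))}

/-- `𝒫_{k₀}`: the group of principal fractional ideals of `k` extended from `k₀`,
i.e. generated by nonzero elements of `k₀`. -/
def principalFromK0 (d : ℕ) : Subgroup ((FractionalIdeal (𝓞 ↥(Kc d))⁰ ↥(Kc d))ˣ) :=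
  Subgroup.closure
    {I | ∃ y : (↥(Kc d))ˣ, ((y : ↥(Kc d)) ∈ k0S d) ∧
      I = toPrincipalIdeal (𝓞 ↥(Kc d)) ↥(Kc d) y}

/-- The quotient `𝒫_k^G/𝒫_{k₀}` of primitive ambiguous principal ideals of `k/k₀`. -/
def ambPrincipalQuot (d : ℕ) (σ : ↥(Kc d) ≃ₐ[ℚ] ↥(Kc d)) :=
  ↥(ambPrincipalK d σ) ⧸ (principalFromK0 d).subgroupOf (ambPrincipalK d σ)

instance (d : ℕ) (σ : ↥(Kc d) ≃ₐ[ℚ] ↥(Kc d)) : CommGroup (ambPrincipalQuot d σ) := by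
  unfold ambPrincipalQuot; infer_instance

/-- `𝒫_L^G`: the group of principal fractional ideals of `L` whose extension to `k`
is `σ`-invariant. -/
def ambPrincipalL (d : ℕ) (σ : ↥(Kc d) ≃ₐ[ℚ] ↥(Kc d)) :
    Subgroup ((FractionalIdeal (𝓞 ↥(LS d))⁰ ↥(LS d))ˣ) :=
  Subgroup.closure
    {I | ∃ x : (↥(LS d))ˣ, I = toPrincipalIdeal (𝓞 ↥(LS d)) ↥(LS d) x ∧
      FractionalIdeal.spanSingleton (𝓞 ↥(Kc d))⁰ (σ (algebraMap ↥(LS d) ↥(Kc d) (x : ↥(LS d)))) =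
        FractionalIdeal.spanSingleton (𝓞 ↥(Kc d))⁰ (algebraMap ↥(LS d) ↥(Kc d) (x : ↥(LS d)))}

/-- `𝒫_ℚ = 𝓘_ℚ`: the group of fractional ideals of `L` generated by nonzero rational
numbers. -/
def principalFromQ (d : ℕ) : Subgroup ((FractionalIdeal (𝓞 ↥(LS d))⁰ ↥(LS d))ˣ) :=
  Subgroup.closure
    {I | ∃ r : ℚˣ,
      I = toPrincipalIdeal (𝓞 ↥(LS d)) ↥(LS d) (Units.map (algebraMap ℚ ↥(LS d)).toMonoidHom r)}

/-- The quotient `𝒫_L^G/𝒫_ℚ` of absolute principal factors. -/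
def absPrincipalFactors (d : ℕ) (σ : ↥(Kc d) ≃ₐ[ℚ] ↥(Kc d)) :=
  ↥(ambPrincipalL d σ) ⧸ (principalFromQ d).subgroupOf (ambPrincipalL d σ)

instance (d : ℕ) (σ : ↥(Kc d) ≃ₐ[ℚ] ↥(Kc d)) : CommGroup (absPrincipalFactors d σ) := by
  unfold absPrincipalFactors; infer_instance

/-- The kernel of the homomorphism `𝒫_k^G/𝒫_{k₀} → 𝓘_L^G/𝓘_ℚ` induced by the relative norm
`N_{k/L}`: the class of an ambiguous principal ideal `(x)` of `k` lies in the kernel if and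
only if the norm `N_{k/L}(x)` generates an ideal of `L` lying in `𝓘_ℚ`, i.e. differs from a
rational number by a unit of `𝓞_L`. -/
def relPrincipalFactors (d : ℕ) (σ : ↥(Kc d) ≃ₐ[ℚ] ↥(Kc d)) :
    Subgroup (ambPrincipalQuot d σ) :=
  Subgroup.closure
    {c | ∃ (x : (↥(Kc d))ˣ)
        (h : FractionalIdeal.spanSingleton (𝓞 ↥(Kc d))⁰ (σ (x : ↥(Kc d))) =
          FractionalIdeal.spanSingleton (𝓞 ↥(Kc d))⁰ (x : ↥(Kc d))),
      QuotientGroup.mk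
        (⟨toPrincipalIdeal (𝓞 ↥(Kc d)) ↥(Kc d) x,
          Subgroup.subset_closure ⟨x, rfl, h⟩⟩ : ↥(ambPrincipalK d σ)) = c ∧
      ∃ (r : ℚˣ) (u : (𝓞 ↥(LS d))ˣ),
        Algebra.norm ↥(LS d) (x : ↥(Kc d)) =
          algebraMap ℚ ↥(LS d) (r : ℚ) * ((u : 𝓞 ↥(LS d)) : ↥(LS d))}

section GroupTheory

/-- The index of the `n`-th powers in a free abelian group of rank `r` is `n ^ r`. -/
lemma index_range_powMonoidHom_of_basis {F : Type*} [CommGroup F] {r : ℕ}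
    (b : Module.Basis (Fin r) ℤ (Additive F)) (n : ℕ) [NeZero n] :
    (powMonoidHom n : F →* F).range.index = n ^ r := by
  let e := b.equivFun
  let f : F →* Multiplicative (Fin r → ZMod n) :=
    { toFun := fun x => Multiplicative.ofAdd fun i => ((e (Additive.ofMul x) i : ℤ) : ZMod n)
      map_one' := by ext i; simp
      map_mul' := fun x y => by
        apply Multiplicative.toAdd.injective
        funext i
        simp }
  have hf : Function.Surjective f := by
    intro v
    let c : Fin r → ℤ := fun i => (ZMod.intCast_surjective (v.toAdd i)).choose
    have hc : ∀ i, ((c i : ℤ) : ZMod n) = v.toAdd i :=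
      fun i => (ZMod.intCast_surjective (v.toAdd i)).choose_spec
    refine ⟨(e.symm c).toMul, ?_⟩
    apply Multiplicative.toAdd.injective
    funext i
    simp [f, hc]
  have hker : f.ker = (powMonoidHom n : F →* F).range := by
    ext x
    rw [MonoidHom.mem_ker, MonoidHom.mem_range]
    constructor
    · intro hx
      have hdvd : ∀ i, (n : ℤ) ∣ e (Additive.ofMul x) i := fun i => by
        rw [← ZMod.intCast_zmod_eq_zero_iff_dvd]
        exact congrFun (congrArg Multiplicative.toAdd hx) i
      choose c hc using hdvd
      refine ⟨(e.symm c).toMul, ?_⟩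
      apply Additive.ofMul.injective
      apply e.injective
      funext i
      simp [powMonoidHom_apply, hc]
    · rintro ⟨y, rfl⟩
      apply Multiplicative.toAdd.injective
      funext i
      simp [f, powMonoidHom_apply]
  rw [← hker, Subgroup.index_ker, MonoidHom.range_eq_top.mpr hf, Subgroup.card_top,
    Nat.card_congr Multiplicative.toAdd]
  simp

variable {E : Type*} [CommGroup E]

/-- The endomorphism `x ↦ s x / x`. -/
def quotHom (s : E →* E) : E →* E := s / MonoidHom.id E

/-- The endomorphism `x ↦ x * s x * s (s x)`. -/
def cubicNormHom (s : E →* E) : E →* E := MonoidHom.id E * s * s.comp s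

@[simp] lemma quotHom_apply (s : E →* E) (x : E) : quotHom s x = s x / x := rfl

@[simp] lemma cubicNormHom_apply (s : E →* E) (x : E) :
    cubicNormHom s x = x * s x * s (s x) := rfl

lemma mem_ker_quotHom {s : E →* E} {x : E} : x ∈ (quotHom s).ker ↔ s x = x := by
  rw [MonoidHom.mem_ker, quotHom_apply, div_eq_one]

/-- The index of `x ↦ s x / x` on an abelian group of rank two on which `1 + s + s²` is torsion. -/
lemma index_range_quotHom (s : E →* E) (hs : ∀ x, s (s (s x)) = x)
    [Finite (CommGroup.torsion E)] (hN : ∀ x, cubicNormHom s x ∈ CommGroup.torsion E)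
    (hrank : (powMonoidHom 3 : E ⧸ CommGroup.torsion E →* _).range.index = 9) :
    (quotHom s).range.index = 3 * Nat.card (quotHom s).ker := by
  set T := CommGroup.torsion E with hT
  have hTs : ∀ f : E →* E, T ≤ T.comap f := fun f x hx => by
    rw [Subgroup.mem_comap]
    exact f.isOfFinOrder hx
  let D := quotHom s
  let D' : E ⧸ T →* E ⧸ T := QuotientGroup.map T T D (hTs D)
  have hD' : ∀ x : E, D' (x : E ⧸ T) = ((s x / x : E) : E ⧸ T) := fun x => rfl
  have hN' : ∀ x : E, (x : E ⧸ T) * (s x : E) * (s (s x) : E) = 1 := fun x => by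
    have := (QuotientGroup.eq_one_iff _).mpr (hN x)
    simpa using this
  have hinj : Function.Injective D' := by
    rw [injective_iff_map_eq_one]
    intro y
    induction y using QuotientGroup.induction_on with | _ x => ?_
    intro hx
    rw [hD', QuotientGroup.mk_div, div_eq_one] at hx
    have h2 : ((s (s x) : E) : E ⧸ T) = (s x : E) := by
      have := congrArg (QuotientGroup.map T T s (hTs s)) hx
      simpa using this
    have h3 := hN' x
    rw [h2, hx, ← pow_two, ← pow_succ] at h3
    exact (pow_eq_one_iff_left (by norm_num)).mp h3
  have hsq : ∀ x : E, D' (D' (x : E ⧸ T)) = (((s x)⁻¹ : E) : E ⧸ T) ^ 3 := fun x => by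
    have h1 : ((s (s x) : E) : E ⧸ T) = (x : E ⧸ T)⁻¹ * ((s x : E) : E ⧸ T)⁻¹ := by
      rw [← mul_inv, eq_inv_iff_mul_eq_one, mul_comm]
      exact hN' x
    rw [hD', hD', map_div]
    simp only [QuotientGroup.mk_div, QuotientGroup.mk_inv, h1]
    generalize ((s x : E) : E ⧸ T) = a
    generalize (x : E ⧸ T) = b
    rw [div_eq_mul_inv, div_eq_mul_inv, div_eq_mul_inv, mul_inv, inv_inv]
    calc b⁻¹ * a⁻¹ * a⁻¹ * (a⁻¹ * b) = (b⁻¹ * b) * (a⁻¹ * a⁻¹ * a⁻¹) := by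
          simp only [mul_assoc, mul_left_comm, mul_comm]
      _ = a⁻¹ ^ 3 := by rw [inv_mul_cancel, one_mul, pow_succ, pow_two]
  have hrange : D'.range.map D' = (powMonoidHom 3 : E ⧸ T →* _).range := by
    ext z
    simp only [Subgroup.mem_map, MonoidHom.mem_range, exists_exists_eq_and, powMonoidHom_apply]
    constructor
    · rintro ⟨y, rfl⟩
      induction y using QuotientGroup.induction_on with | _ x => ?_
      exact ⟨_, (hsq x).symm⟩
    · rintro ⟨y, rfl⟩
      induction y using QuotientGroup.induction_on with | _ x => ?_
      refine ⟨((s (s x⁻¹) : E) : E ⧸ T), ?_⟩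
      rw [hsq, hs, inv_inv]
  have h3 : D'.range.index = 3 := by
    have := Subgroup.index_map_of_injective D'.range hinj
    rw [hrange, hrank] at this
    nlinarith
  have hsup : D'.range.comap (QuotientGroup.mk' T) = D.range ⊔ T := by
    ext x
    simp only [Subgroup.mem_comap, MonoidHom.mem_range, Subgroup.mem_sup, QuotientGroup.mk'_apply,
      exists_exists_eq_and]
    constructor
    · rintro ⟨y, hy⟩
      induction y using QuotientGroup.induction_on with | _ y => ?_
      refine ⟨y, (D y)⁻¹ * x, QuotientGroup.eq.mp hy, by simp⟩
    · rintro ⟨y, t, ht, rfl⟩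
      refine ⟨(y : E ⧸ T), ?_⟩
      rw [QuotientGroup.mk_mul, (QuotientGroup.eq_one_iff t).mpr ht, mul_one]
      rfl
  have hsup3 : (D.range ⊔ T).index = 3 := by
    rw [← hsup, Subgroup.index_comap_of_surjective _ (QuotientGroup.mk'_surjective T), h3]
  have hDT : D.range ⊓ T = T.map D := by
    apply le_antisymm
    · rintro _ ⟨⟨y, rfl⟩, hy⟩
      refine ⟨y, ?_, rfl⟩
      have : D' (y : E ⧸ T) = 1 := (QuotientGroup.eq_one_iff (D y)).mpr hy
      exact (QuotientGroup.eq_one_iff y).mp (hinj (this.trans (map_one D').symm))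
    · rintro _ ⟨y, hy, rfl⟩
      exact ⟨⟨y, rfl⟩, hTs D hy⟩
  have hkerT : D.ker ≤ T := fun x hx => by
    refine (QuotientGroup.eq_one_iff x).mp (hinj ?_)
    rw [map_one]
    exact (QuotientGroup.eq_one_iff (D x)).mpr (by rw [MonoidHom.mem_ker.mp hx]; exact one_mem T)
  have e1 : D.range.relIndex T * Nat.card (T.map D) = Nat.card T := by
    have : D.range.relIndex T = (T.map D).relIndex T := by
      rw [← hDT, Subgroup.inf_relIndex_right]
    rw [this, mul_comm]
    have hle : T.map D ≤ T := hDT ▸ inf_le_right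
    simpa [Subgroup.relIndex_bot_left] using
      Subgroup.relIndex_mul_relIndex ⊥ (T.map D) T bot_le hle
  have e2 : Nat.card D.ker * Nat.card (T.map D) = Nat.card T := by
    rw [← Subgroup.relIndex_ker]
    simpa [Subgroup.relIndex_bot_left] using
      Subgroup.relIndex_mul_relIndex ⊥ D.ker T bot_le hkerT
  have hfin : Finite (T.map D) := Finite.of_surjective (fun t : T => (⟨D t, t, t.2, rfl⟩ : T.map D))
    (by rintro ⟨_, t, ht, rfl⟩; exact ⟨⟨t, ht⟩, rfl⟩)
  have e3 : D.range.relIndex T = Nat.card D.ker :=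
    Nat.eq_of_mul_eq_mul_right Nat.card_pos (e1.trans e2.symm)
  have e4 := Subgroup.relIndex_mul_index (le_sup_left : D.range ≤ D.range ⊔ T)
  rw [sup_comm, Subgroup.relIndex_sup_right, e3, sup_comm, hsup3] at e4
  rw [← e4, mul_comm]

/-- The Herbrand quotient of an abelian group of rank two on which `1 + s + s²` is torsion. -/
lemma relIndex_range_quotHom_ker_cubicNormHom (s : E →* E) (hs : ∀ x, s (s (s x)) = x)
    [Finite (CommGroup.torsion E)] (hN : ∀ x, cubicNormHom s x ∈ CommGroup.torsion E)
    (hrank : (powMonoidHom 3 : E ⧸ CommGroup.torsion E →* _).range.index = 9) :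
    (quotHom s).range.relIndex (cubicNormHom s).ker =
      3 * (cubicNormHom s).range.relIndex (quotHom s).ker := by
  have h1 : (quotHom s).range ≤ (cubicNormHom s).ker := by
    rintro _ ⟨x, rfl⟩
    rw [MonoidHom.mem_ker, cubicNormHom_apply, quotHom_apply, map_div, map_div, hs]
    simp
  have h2 : (cubicNormHom s).range ≤ (quotHom s).ker := by
    rintro _ ⟨x, rfl⟩
    rw [mem_ker_quotHom, cubicNormHom_apply, map_mul, map_mul, hs, mul_comm, mul_assoc]
  have hfin : Finite (cubicNormHom s).range := by
    refine Finite.of_injective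
      (fun y => (⟨y, ?_⟩ : CommGroup.torsion E)) fun a b hab => Subtype.ext (by simpa using hab)
    obtain ⟨_, x, rfl⟩ := y
    exact hN x
  have e1 := Subgroup.relIndex_mul_index h1
  rw [Subgroup.index_ker, index_range_quotHom s hs hN hrank] at e1
  have e2 := Subgroup.relIndex_mul_relIndex ⊥ _ _ bot_le h2
  rw [Subgroup.relIndex_bot_left, Subgroup.relIndex_bot_left] at e2
  refine Nat.eq_of_mul_eq_mul_right (Nat.card_pos (α := (cubicNormHom s).range)) ?_
  rw [e1, ← e2]
  ring

end GroupTheory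

section GroupTransfer

variable {E M : Type*} [CommGroup E] [CommGroup M]

/-- If `s` satisfies Hilbert 90 on `M`, the elements of `M` that are `s`-invariant up to the
subgroup `E`, modulo `E` and the `s`-invariant elements, are counted by the cohomology of `E`. -/
lemma relIndex_comap_quotHom (ι : E →* M) (hι : Function.Injective ι) (t : E →* E) (s : M →* M)
    (hts : ∀ x, ι (t x) = s (ι x)) (h90 : (quotHom s).range = (cubicNormHom s).ker) :
    ((quotHom s).ker ⊔ ι.range).relIndex (ι.range.comap (quotHom s)) =
      (quotHom t).range.relIndex (cubicNormHom t).ker := by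
  have h1 : (quotHom t).range.map ι = ((quotHom s).ker ⊔ ι.range).map (quotHom s) := by
    rw [Subgroup.map_sup, (Subgroup.map_eq_bot_iff _).mpr le_rfl, bot_sup_eq, MonoidHom.map_range,
      MonoidHom.map_range]
    congr 1
    ext x
    simp [hts]
  have h2 : (cubicNormHom t).ker.map ι = (ι.range.comap (quotHom s)).map (quotHom s) := by
    rw [Subgroup.map_comap_eq, h90]
    ext x
    simp only [Subgroup.mem_map, MonoidHom.mem_ker, Subgroup.mem_inf, MonoidHom.mem_range,
      cubicNormHom_apply]
    constructor
    · rintro ⟨y, hy, rfl⟩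
      refine ⟨?_, y, rfl⟩
      rw [← hts, ← hts, ← map_mul, ← map_mul, hy, map_one]
    · rintro ⟨hy, y, rfl⟩
      refine ⟨y, hι ?_, rfl⟩
      rw [map_mul, map_mul, hts, hts, hts, hy, map_one]
  rw [← Subgroup.relIndex_map_map_of_injective _ _ hι, h1, h2, Subgroup.relIndex_map_map]
  congr 1
  · rw [sup_comm, sup_assoc, sup_idem, sup_comm]
  · rw [sup_eq_left.mpr]
    intro x hx
    rw [Subgroup.mem_comap, MonoidHom.mem_ker.mp hx]
    exact one_mem _

lemma card_map_mk_subgroupOf {I : Type*} [CommGroup I] {A B C : Subgroup I} (h : C ≤ A) :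
    Nat.card ((C.subgroupOf A).map (QuotientGroup.mk' (B.subgroupOf A))) = B.relIndex C := by
  rw [← Subgroup.relIndex_bot_left, ← Subgroup.relIndex_comap, MonoidHom.comap_bot,
    QuotientGroup.ker_mk', Subgroup.relIndex_subgroupOf h]

lemma closure_eq_map {G H : Type*} [Group G] [Group H] (f : G →* H) (X : Subgroup G)
    {S : Set H} (hS : ∀ y, y ∈ S ↔ ∃ x ∈ X, f x = y) : Subgroup.closure S = X.map f := by
  rw [← Subgroup.closure_eq (X.map f)]
  congr 1
  ext y
  exact hS y

end GroupTransfer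

section Units

variable (K : Type*) [Field K]

/-- The unit group of the ring of integers, as a subgroup of `Kˣ`. -/
def integralUnits : Subgroup Kˣ :=
  (Units.map (algebraMap (𝓞 K) K : 𝓞 K →* K)).range

variable {K}

lemma units_ringOfIntegers_ext {u v : (𝓞 K)ˣ} (h : ((u : 𝓞 K) : K) = ((v : 𝓞 K) : K)) : u = v :=
  Units.ext (RingOfIntegers.ext h)

lemma mem_integralUnits_iff_exists {x : Kˣ} :
    x ∈ integralUnits K ↔ ∃ u : (𝓞 K)ˣ, ((u : 𝓞 K) : K) = x := by
  simp only [integralUnits, MonoidHom.mem_range, Units.ext_iff]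
  rfl

lemma mem_integralUnits {x : Kˣ} :
    x ∈ integralUnits K ↔ IsIntegral ℤ (x : K) ∧ IsIntegral ℤ ((x⁻¹ : Kˣ) : K) := by
  constructor
  · rintro ⟨u, rfl⟩
    refine ⟨RingOfIntegers.isIntegral_coe _, ?_⟩
    rw [← map_inv]
    exact RingOfIntegers.isIntegral_coe _
  · rintro ⟨h, h'⟩
    refine ⟨⟨⟨x, h⟩, ⟨_, h'⟩, ?_, ?_⟩, ?_⟩
    · ext; exact x.mul_inv
    · ext; exact x.inv_mul
    · ext; rfl

lemma map_mem_integralUnits_iff {L : Type*} [Field L] (f : L →+* K) {x : Lˣ} :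
    Units.map (f : L →* K) x ∈ integralUnits K ↔ x ∈ integralUnits L := by
  rw [mem_integralUnits, mem_integralUnits, ← map_inv]
  exact and_congr (isIntegral_algHom_iff (f.toIntAlgHom) f.injective)
    (isIntegral_algHom_iff (f.toIntAlgHom) f.injective)

lemma map_norm_mem_integralUnits {L : Type*} [Field L] [Algebra L K] [FiniteDimensional L K]
    {x : Kˣ} (hx : x ∈ integralUnits K) :
    Units.map (Algebra.norm L) x ∈ integralUnits L := by
  rw [mem_integralUnits] at hx ⊢
  rw [← map_inv]
  exact ⟨Algebra.isIntegral_norm L hx.1, Algebra.isIntegral_norm L hx.2⟩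

lemma spanSingleton_eq_spanSingleton_iff_div_mem [NumberField K] {x y : Kˣ} :
    FractionalIdeal.spanSingleton (𝓞 K)⁰ (y : K) = FractionalIdeal.spanSingleton (𝓞 K)⁰ (x : K) ↔
      y / x ∈ integralUnits K := by
  rw [eq_comm, FractionalIdeal.spanSingleton_eq_spanSingleton, mem_integralUnits_iff_exists]
  refine exists_congr fun u => ?_
  rw [Units.smul_def, Algebra.smul_def, Units.val_div_eq_div_val, eq_div_iff x.ne_zero]

lemma ker_toPrincipalIdeal [NumberField K] : (toPrincipalIdeal (𝓞 K) K).ker = integralUnits K := by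
  ext x
  rw [MonoidHom.mem_ker, toPrincipalIdeal_eq_iff, ← div_one x,
    ← spanSingleton_eq_spanSingleton_iff_div_mem]
  simp

end Units

section PrimeDegree

variable {F K : Type*} [Field F] [Field K] [Algebra F K] [FiniteDimensional F K] [IsGalois F K]

lemma orderOf_eq_of_finrank_prime {p : ℕ} [hp : Fact p.Prime] (h : Module.finrank F K = p)
    {σ : Gal(K/F)} (hσ : σ ≠ 1) : orderOf σ = p := by
  refine orderOf_eq_prime ?_ hσ
  rw [← h, ← IsGalois.card_aut_eq_finrank, pow_card_eq_one']

lemma exists_pow_eq_of_finrank_prime {p : ℕ} [hp : Fact p.Prime] (h : Module.finrank F K = p)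
    {σ : Gal(K/F)} (hσ : σ ≠ 1) (g : Gal(K/F)) : ∃ i < p, σ ^ i = g := by
  classical
  have hg : g ∈ Subgroup.zpowers σ :=
    mem_zpowers_of_prime_card (p := p) ((IsGalois.card_aut_eq_finrank F K).trans h) hσ
  rw [mem_zpowers_iff_mem_range_orderOf, orderOf_eq_of_finrank_prime h hσ] at hg
  simpa using hg

lemma algebraMap_norm_eq_prod_range {p : ℕ} [hp : Fact p.Prime] (h : Module.finrank F K = p)
    {σ : Gal(K/F)} (hσ : σ ≠ 1) (x : K) :
    algebraMap F K (Algebra.norm F x) = ∏ i ∈ Finset.range p, (σ ^ i) x := by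
  rw [Algebra.norm_eq_prod_automorphisms]
  symm
  refine Finset.prod_bij (fun i _ => σ ^ i) (fun _ _ => Finset.mem_univ _) ?_ ?_ fun _ _ => rfl
  · intro i hi j hj hij
    rw [← orderOf_eq_of_finrank_prime h hσ, Finset.mem_range] at hi hj
    exact pow_injOn_Iio_orderOf hi hj hij
  · intro g _
    obtain ⟨i, hi, rfl⟩ := exists_pow_eq_of_finrank_prime h hσ g
    exact ⟨i, Finset.mem_range.mpr hi, rfl⟩

lemma mem_range_algebraMap_of_apply_eq {p : ℕ} [hp : Fact p.Prime] (h : Module.finrank F K = p)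
    {σ : Gal(K/F)} (hσ : σ ≠ 1) {x : K} (hx : σ x = x) : x ∈ Set.range (algebraMap F K) := by
  rw [IsGalois.mem_range_algebraMap_iff_fixed]
  intro g
  obtain ⟨i, -, rfl⟩ := exists_pow_eq_of_finrank_prime h hσ g
  induction i with
  | zero => rfl
  | succ i ih => rw [pow_succ, AlgEquiv.mul_apply, hx, ih]

end PrimeDegree

/-- Hilbert 90 for cyclic cubic extensions. -/
lemma exists_eq_apply_div_of_cubic {F K : Type} [Field F] [Field K] [Algebra F K]
    [FiniteDimensional F K] [IsGalois F K] (h : Module.finrank F K = 3)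
    {σ : Gal(K/F)} (hσ : σ ≠ 1) {x : K} (hx : x * σ x * σ (σ x) = 1) :
    ∃ y : Kˣ, x = σ y / y := by
  have hcard : Nat.card Gal(K/F) = 3 := (IsGalois.card_aut_eq_finrank F K).trans h
  have : IsCyclic Gal(K/F) := isCyclic_of_prime_card hcard
  have hnorm : Algebra.norm F x = 1 := by
    apply (algebraMap F K).injective
    rw [algebraMap_norm_eq_prod_range h hσ, map_one, ← hx]
    simp [Finset.prod_range_succ]
  obtain ⟨y, rfl⟩ := groupCohomology.exists_div_of_norm_eq_one
    (fun g => mem_zpowers_of_prime_card hcard hσ (g' := g)) hnorm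
  refine ⟨y⁻¹, ?_⟩
  rw [Units.val_inv_eq_inv_val, map_inv₀]
  field_simp

lemma map_mem_of_finrank_eq_two {Q K : Type*} [Field Q] [Field K] [Algebra Q K]
    {F : IntermediateField Q K} (hF : Module.finrank Q F = 2) (f : K →ₐ[Q] K) {x : K}
    (hx : x ∈ F) : f x ∈ F := by
  have : Module.Finite Q F := Module.finite_of_finrank_eq_succ hF
  have : Algebra.IsQuadraticExtension Q F := ⟨hF⟩
  rw [← AlgHom.fieldRange_of_normal (E := F) (f.comp F.val)]
  exact ⟨⟨x, hx⟩, rfl⟩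

section PureCubic

variable {K : Type} [Field K] [NumberField K]

lemma finrank_adjoin_primitiveRoot_three {ζ : K} (hζ : IsPrimitiveRoot ζ 3) :
    Module.finrank ℚ ℚ⟮ζ⟯ = 2 := by
  rw [IntermediateField.adjoin.finrank (Algebra.IsIntegral.isIntegral _),
    ← Polynomial.cyclotomic_eq_minpoly_rat hζ (by norm_num),
    Polynomial.natDegree_cyclotomic]
  rfl

lemma IsCubeFree.pow_three_ne {d : ℕ} (hd : 1 < d) (h : IsCubeFree d) (b : ℚ) :
    b ^ 3 ≠ d := by
  intro hb
  obtain ⟨n, hn⟩ := IsIntegrallyClosed.exists_algebraMap_eq_of_isIntegral_pow (R := ℤ) (x := b)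
    (n := 3) (by norm_num) (by rw [hb]; exact isIntegral_algebraMap (x := (d : ℤ)))
  rw [← hn] at hb
  have hn3 : n ^ 3 = d := by
    rw [eq_intCast] at hb
    exact_mod_cast hb
  have habs : n.natAbs ^ 3 = d := by rw [← Int.natAbs_pow, hn3, Int.natAbs_natCast]
  have hne : n.natAbs ≠ 1 := by
    intro h1
    rw [h1] at habs
    omega
  obtain ⟨p, hp, hpn⟩ := Nat.exists_prime_and_dvd hne
  exact h p hp (habs ▸ pow_dvd_pow_of_dvd hpn 3)

lemma finrank_adjoin_cubeRoot {d : ℕ} (hd : 1 < d) (h : IsCubeFree d) {c : K}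
    (hc : c ^ 3 = d) : Module.finrank ℚ ℚ⟮c⟯ = 3 := by
  rw [IntermediateField.adjoin.finrank (Algebra.IsIntegral.isIntegral _),
    ← minpoly.eq_of_irreducible_of_monic
      ((X_pow_sub_C_irreducible_iff_of_prime Nat.prime_three).mpr (h.pow_three_ne hd))
      (by simp [hc]) (Polynomial.monic_X_pow_sub_C _ (by norm_num)),
    Polynomial.natDegree_X_pow_sub_C]

variable {F L : IntermediateField ℚ K}

lemma finrank_eq_six (hF : Module.finrank ℚ F = 2) (hL : Module.finrank ℚ L = 3)
    (hLF : L ⊔ F = ⊤) : Module.finrank ℚ K = 6 := by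
  have h1 := IntermediateField.finrank_sup_le L F
  rw [hLF, IntermediateField.finrank_top', hF, hL] at h1
  have h2 := Module.finrank_mul_finrank ℚ F K
  have h3 := Module.finrank_mul_finrank ℚ L K
  have h4 : 0 < Module.finrank ℚ K := Module.finrank_pos
  rw [hF] at h2
  rw [hL] at h3
  omega

lemma finrank_eq_three (hF : Module.finrank ℚ F = 2) (hK : Module.finrank ℚ K = 6) :
    Module.finrank F K = 3 := by
  have h2 := Module.finrank_mul_finrank ℚ F K
  rw [hF, hK] at h2
  omega

lemma finrank_eq_two (hL : Module.finrank ℚ L = 3) (hK : Module.finrank ℚ K = 6) :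
    Module.finrank L K = 2 := by
  have h2 := Module.finrank_mul_finrank ℚ L K
  rw [hL, hK] at h2
  omega

lemma exists_rat_of_mem_of_mem (hF : Module.finrank ℚ F = 2) (hL : Module.finrank ℚ L = 3)
    {x : K} (hxF : x ∈ F) (hxL : x ∈ L) : ∃ r : ℚ, (r : K) = x := by
  have h1 : Module.finrank ℚ (F ⊓ L : IntermediateField ℚ K) ∣ 2 :=
    hF ▸ IntermediateField.finrank_dvd_of_le_right inf_le_left
  have h2 : Module.finrank ℚ (F ⊓ L : IntermediateField ℚ K) ∣ 3 :=
    hL ▸ IntermediateField.finrank_dvd_of_le_right inf_le_right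
  have h3 : F ⊓ L = ⊥ :=
    IntermediateField.finrank_eq_one_iff.mp (Nat.dvd_one.mp (by simpa using Nat.dvd_gcd h1 h2))
  have h4 : x ∈ F ⊓ L := ⟨hxF, hxL⟩
  rw [h3, IntermediateField.mem_bot] at h4
  obtain ⟨r, hr⟩ := h4
  exact ⟨r, by simpa using hr⟩

lemma isGalois_of_finrank_prime {F K : Type*} [Field F] [Field K] [Algebra F K]
    [FiniteDimensional F K] {p : ℕ} [hp : Fact p.Prime]
    (h : Module.finrank F K = p) {σ : Gal(K/F)} (hσ : σ ≠ 1) : IsGalois F K := by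
  apply IsGalois.of_card_aut_eq_finrank
  have h1 := IntermediateField.finrank_fixedField_eq_card (⊤ : Subgroup Gal(K/F))
  rw [Subgroup.card_top] at h1
  have h2 := Module.finrank_mul_finrank F (IntermediateField.fixedField (⊤ : Subgroup Gal(K/F))) K
  rw [h1, h] at h2
  have : Nontrivial Gal(K/F) := ⟨⟨σ, 1, hσ⟩⟩
  rw [h]
  exact ((Nat.dvd_prime hp.out).mp (Dvd.intro_left _ h2)).resolve_left
    (Finite.one_lt_card (α := Gal(K/F))).ne'

lemma isTotallyComplex_of_primitiveRoot_three {ζ : K} (hζ : IsPrimitiveRoot ζ 3) :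
    IsTotallyComplex K :=
  nrRealPlaces_eq_zero_iff.mp
    (InfinitePlace.IsPrimitiveRoot.nrRealPlaces_eq_zero_of_two_lt (by norm_num) hζ)

lemma units_rank_add_one_mul_two [IsTotallyComplex K] :
    (NumberField.Units.rank K + 1) * 2 = Module.finrank ℚ K := by
  have h1 := InfinitePlace.card_eq_nrRealPlaces_add_nrComplexPlaces K
  rw [nrRealPlaces_eq_zero_iff.mpr inferInstance] at h1
  have h2 := IsTotallyComplex.finrank K
  have h3 : 0 < Fintype.card (InfinitePlace K) := Fintype.card_pos
  rw [NumberField.Units.rank]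
  omega

lemma index_range_powMonoidHom_units (n : ℕ) [NeZero n] :
    (powMonoidHom n : (𝓞 K)ˣ ⧸ CommGroup.torsion (𝓞 K)ˣ →* _).range.index =
      n ^ NumberField.Units.rank K :=
  index_range_powMonoidHom_of_basis (F := (𝓞 K)ˣ ⧸ NumberField.Units.torsion K)
    (NumberField.Units.basisModTorsion K) n

lemma units_mem_torsion_of_rank_eq_zero (h : NumberField.Units.rank K = 0) (u : (𝓞 K)ˣ) :
    u ∈ CommGroup.torsion (𝓞 K)ˣ := by
  obtain ⟨⟨ζ, e⟩, rfl, -⟩ := NumberField.Units.exist_unique_eq_mul_prod K u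
  have : IsEmpty (Fin (NumberField.Units.rank K)) := by rw [h]; infer_instance
  rw [Finset.univ_eq_empty, Finset.prod_empty, mul_one]
  exact ζ.2

end PureCubic

section CubicAutomorphism

variable {K : Type} [Field K] [NumberField K] {F : IntermediateField ℚ K}

/-- An automorphism fixing an intermediate field pointwise, as an automorphism over that field. -/
def algEquivOfFixes (σ : K ≃ₐ[ℚ] K) (hfix : ∀ x ∈ F, σ x = x) : Gal(K/F) :=
  AlgEquiv.ofRingEquiv (f := σ.toRingEquiv) fun x => hfix x x.2

@[simp]
lemma algEquivOfFixes_apply (σ : K ≃ₐ[ℚ] K) (hfix : ∀ x ∈ F, σ x = x) (x : K) :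
    algEquivOfFixes σ hfix x = σ x := rfl

lemma algEquivOfFixes_ne_one {σ : K ≃ₐ[ℚ] K} (hfix : ∀ x ∈ F, σ x = x) (hσ : σ ≠ 1) :
    algEquivOfFixes σ hfix ≠ 1 := fun h =>
  hσ (AlgEquiv.ext fun x => DFunLike.congr_fun h x)

lemma apply_eq_self_iff_of_cubic {σ : K ≃ₐ[ℚ] K} (hK : Module.finrank F K = 3)
    (hfix : ∀ x ∈ F, σ x = x) (hσ : σ ≠ 1) {x : K} : σ x = x ↔ x ∈ F := by
  have hne := algEquivOfFixes_ne_one hfix hσ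
  have := isGalois_of_finrank_prime hK hne
  refine ⟨fun h => ?_, hfix x⟩
  obtain ⟨y, rfl⟩ := mem_range_algebraMap_of_apply_eq hK hne (x := x) h
  exact y.2

lemma apply_apply_apply_of_cubic {σ : K ≃ₐ[ℚ] K} (hK : Module.finrank F K = 3)
    (hfix : ∀ x ∈ F, σ x = x) (hσ : σ ≠ 1) (x : K) : σ (σ (σ x)) = x := by
  have hne := algEquivOfFixes_ne_one hfix hσ
  have := isGalois_of_finrank_prime hK hne
  have h := pow_orderOf_eq_one (algEquivOfFixes σ hfix)
  rw [orderOf_eq_of_finrank_prime hK hne] at h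
  exact DFunLike.congr_fun h x

lemma coe_norm_of_cubic {σ : K ≃ₐ[ℚ] K} (hK : Module.finrank F K = 3)
    (hfix : ∀ x ∈ F, σ x = x) (hσ : σ ≠ 1) (x : K) :
    (Algebra.norm F x : K) = x * σ x * σ (σ x) := by
  have hne := algEquivOfFixes_ne_one hfix hσ
  have := isGalois_of_finrank_prime hK hne
  refine (algebraMap_norm_eq_prod_range hK hne x).trans ?_
  simp [Finset.prod_range_succ]

lemma range_quotHom_eq_ker_cubicNormHom {σ : K ≃ₐ[ℚ] K} (hK : Module.finrank F K = 3)
    (hfix : ∀ x ∈ F, σ x = x) (hσ : σ ≠ 1) :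
    (quotHom (Units.map (σ : K →* K))).range = (cubicNormHom (Units.map (σ : K →* K))).ker := by
  have hne := algEquivOfFixes_ne_one hfix hσ
  have := isGalois_of_finrank_prime hK hne
  ext x
  rw [MonoidHom.mem_ker, cubicNormHom_apply]
  constructor
  · rintro ⟨y, rfl⟩
    ext
    have h0 : ∀ z : Kˣ, σ (z : K) ≠ 0 := fun z => by simp
    have h1 : σ (σ (y : K)) ≠ 0 := by simp
    simp [quotHom_apply, apply_apply_apply_of_cubic hK hfix hσ]
  · intro h
    obtain ⟨y, hy⟩ := exists_eq_apply_div_of_cubic hK hne (x := (x : K)) (by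
      simpa [Units.ext_iff] using h)
    exact ⟨y, Units.ext (by simpa [quotHom_apply] using hy.symm)⟩

lemma eq_of_cubic {σ : K ≃ₐ[ℚ] K} (hK : Module.finrank F K = 3)
    (hfix : ∀ x ∈ F, σ x = x) (hσ : σ ≠ 1) {g : K ≃ₐ[ℚ] K} (hg : ∀ x ∈ F, g x = x) :
    (∀ x, g x = x) ∨ (∀ x, g x = σ x) ∨ ∀ x, g x = σ (σ x) := by
  have hne := algEquivOfFixes_ne_one hfix hσ
  have := isGalois_of_finrank_prime hK hne
  obtain ⟨i, hi, h⟩ := exists_pow_eq_of_finrank_prime hK hne (algEquivOfFixes g hg)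
  have hx := fun x => (DFunLike.congr_fun h x).symm
  interval_cases i
  · exact Or.inl hx
  · exact Or.inr (Or.inl hx)
  · exact Or.inr (Or.inr hx)

lemma exists_quadratic_automorphism {L : IntermediateField ℚ K} (hK : Module.finrank L K = 2) :
    ∃ τ : K ≃ₐ[ℚ] K, (∃ x, τ x ≠ x) ∧ (∀ x, τ (τ x) = x) ∧ (∀ x, τ x = x ↔ x ∈ L) ∧
      ∀ x, (Algebra.norm L x : K) = x * τ x := by
  have : Algebra.IsQuadraticExtension L K := ⟨hK⟩
  have hcard : Nat.card Gal(K/L) = 2 := (IsGalois.card_aut_eq_finrank L K).trans hK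
  have : Nontrivial Gal(K/L) := Finite.one_lt_card_iff_nontrivial.mp (by omega)
  obtain ⟨τ, hτ⟩ := exists_ne (1 : Gal(K/L))
  have : Fact (Nat.Prime 2) := ⟨Nat.prime_two⟩
  refine ⟨τ.restrictScalars ℚ, ?_, ?_, fun x => ⟨fun h => ?_, fun h => ?_⟩, fun x => ?_⟩
  · by_contra! h
    exact hτ (AlgEquiv.ext h)
  · have h := pow_orderOf_eq_one τ
    rw [orderOf_eq_of_finrank_prime hK hτ] at h
    exact fun x => DFunLike.congr_fun h x
  · obtain ⟨y, rfl⟩ := mem_range_algebraMap_of_apply_eq hK hτ (x := x) h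
    exact y.2
  · exact τ.commutes ⟨x, h⟩
  · refine (algebraMap_norm_eq_prod_range hK hτ x).trans ?_
    simp [Finset.prod_range_succ]

end CubicAutomorphism

section UnitIndex

variable {K : Type} [Field K] [NumberField K] {F : IntermediateField ℚ K}

/-- The action of a field automorphism on the units of the ring of integers. -/
def unitsMap (σ : K ≃ₐ[ℚ] K) : (𝓞 K)ˣ →* (𝓞 K)ˣ :=
  Units.map (RingOfIntegers.mapRingEquiv σ.toRingEquiv : 𝓞 K →* 𝓞 K)

lemma coe_unitsMap (σ : K ≃ₐ[ℚ] K) (u : (𝓞 K)ˣ) :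
    ((unitsMap σ u : 𝓞 K) : K) = σ ((u : 𝓞 K) : K) := rfl

lemma coe_cubicNormHom_unitsMap (σ : K ≃ₐ[ℚ] K) (u : (𝓞 K)ˣ) :
    ((cubicNormHom (unitsMap σ) u : 𝓞 K) : K) =
      ((u : 𝓞 K) : K) * σ ((u : 𝓞 K) : K) * σ (σ ((u : 𝓞 K) : K)) := by
  rw [cubicNormHom_apply]
  push_cast
  rfl

variable {σ : K ≃ₐ[ℚ] K}

lemma range_units_map_algebraMap (hK : Module.finrank F K = 3)
    (hfix : ∀ x ∈ F, σ x = x) (hσ : σ ≠ 1) :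
    (Units.map (algebraMap (𝓞 F) (𝓞 K) : 𝓞 F →* 𝓞 K)).range = (quotHom (unitsMap σ)).ker := by
  ext u
  rw [mem_ker_quotHom]
  constructor
  · rintro ⟨v, rfl⟩
    exact units_ringOfIntegers_ext (hfix _ ((v : 𝓞 F) : F).2)
  · intro h
    have hF : ((u : 𝓞 K) : K) ∈ F := by
      rw [← apply_eq_self_iff_of_cubic hK hfix hσ, ← coe_unitsMap, h]
    let x : Fˣ := Units.mk0 ⟨((u : 𝓞 K) : K), hF⟩ fun h0 => by
      have : ((u : 𝓞 K) : K) = 0 := congrArg Subtype.val h0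
      simp at this
    have hx : x ∈ integralUnits F := by
      rw [← map_mem_integralUnits_iff (algebraMap F K), mem_integralUnits_iff_exists]
      exact ⟨u, rfl⟩
    obtain ⟨v, hv⟩ := mem_integralUnits_iff_exists.mp hx
    exact ⟨v, units_ringOfIntegers_ext (congrArg (algebraMap F K) hv)⟩

lemma index_range_units_map_norm (hK : Module.finrank F K = 3)
    (hfix : ∀ x ∈ F, σ x = x) (hσ : σ ≠ 1) :
    (Units.map (RingOfIntegers.norm F : 𝓞 K →* 𝓞 F)).range.index =
      (cubicNormHom (unitsMap σ)).range.relIndex (quotHom (unitsMap σ)).ker := by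
  have hi : ∀ v : (𝓞 K)ˣ, Units.map (algebraMap (𝓞 F) (𝓞 K) : 𝓞 F →* 𝓞 K)
      (Units.map (RingOfIntegers.norm F : 𝓞 K →* 𝓞 F) v) = cubicNormHom (unitsMap σ) v := by
    intro v
    apply units_ringOfIntegers_ext
    rw [coe_cubicNormHom_unitsMap, ← coe_norm_of_cubic hK hfix hσ]
    rfl
  have hinj : Function.Injective (Units.map (algebraMap (𝓞 F) (𝓞 K) : 𝓞 F →* 𝓞 K)) :=
    Units.map_injective (RingOfIntegers.algebraMap.injective F K)
  rw [← range_units_map_algebraMap hK hfix hσ, ← Subgroup.index_comap]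
  congr 1
  ext u
  rw [Subgroup.mem_comap]
  constructor
  · rintro ⟨v, rfl⟩
    exact ⟨v, (hi v).symm⟩
  · rintro ⟨v, hv⟩
    exact ⟨v, hinj ((hi v).trans hv)⟩

lemma relIndex_ambiguous_eq (hF : Module.finrank ℚ F = 2) {ζ : K} (hζ : IsPrimitiveRoot ζ 3)
    (hζF : ζ ∈ F) (hK : Module.finrank F K = 3) (hfix : ∀ x ∈ F, σ x = x) (hσ : σ ≠ 1) :
    ((quotHom (Units.map (σ : K →* K))).ker ⊔ integralUnits K).relIndex
        ((integralUnits K).comap (quotHom (Units.map (σ : K →* K)))) =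
      3 * (Units.map (RingOfIntegers.norm F : 𝓞 K →* 𝓞 F)).range.index := by
  have hζ' : IsPrimitiveRoot (⟨ζ, hζF⟩ : F) 3 :=
    IsPrimitiveRoot.of_map_of_injective (f := F.val) hζ F.val.injective
  have hKtc := isTotallyComplex_of_primitiveRoot_three hζ
  have hFtc := isTotallyComplex_of_primitiveRoot_three hζ'
  have hrankF : NumberField.Units.rank F = 0 := by
    have := units_rank_add_one_mul_two (K := F)
    have h : Module.finrank ℚ F = 2 := hF
    omega
  have hrankK : NumberField.Units.rank K = 2 := by
    have := units_rank_add_one_mul_two (K := K)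
    have h := Module.finrank_mul_finrank ℚ F K
    rw [hF, hK] at h
    omega
  have hfin : Finite (CommGroup.torsion (𝓞 K)ˣ) :=
    inferInstanceAs (Finite (NumberField.Units.torsion K))
  rw [index_range_units_map_norm hK hfix hσ, ← relIndex_range_quotHom_ker_cubicNormHom]
  · refine relIndex_comap_quotHom _
      (Units.map_injective RingOfIntegers.coe_injective) (unitsMap σ) _ (fun x => rfl)
      (range_quotHom_eq_ker_cubicNormHom hK hfix hσ)
  · exact fun x => units_ringOfIntegers_ext (apply_apply_apply_of_cubic hK hfix hσ _)
  · intro u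
    have h : cubicNormHom (unitsMap σ) u ∈ (quotHom (unitsMap σ)).ker := by
      rw [mem_ker_quotHom]
      apply units_ringOfIntegers_ext
      rw [coe_unitsMap, coe_cubicNormHom_unitsMap, map_mul, map_mul,
        apply_apply_apply_of_cubic hK hfix hσ]
      ring
    rw [← range_units_map_algebraMap hK hfix hσ] at h
    obtain ⟨v, hv⟩ := h
    rw [← hv, CommGroup.mem_torsion]
    exact MonoidHom.isOfFinOrder _
      ((CommGroup.mem_torsion _).mp (units_mem_torsion_of_rank_eq_zero hrankF v))
  · rw [index_range_powMonoidHom_units, hrankK]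
    rfl

end UnitIndex

section AmbiguousNorm

variable {K : Type} [Field K] [NumberField K] {F L : IntermediateField ℚ K}

/-- The elements that `σ` changes only by a unit, i.e. the generators of the ambiguous
principal ideals. -/
def ambiguousElements (σ : K ≃ₐ[ℚ] K) : Subgroup Kˣ :=
  (integralUnits K).comap (quotHom (Units.map (σ : K →* K)))

lemma mem_ambiguousElements {σ : K ≃ₐ[ℚ] K} {x : Kˣ} :
    x ∈ ambiguousElements σ ↔ Units.map (σ : K →* K) x / x ∈ integralUnits K := Iff.rfl

/-- The products of a rational number and a unit. -/
def rationalTimesUnits (L : Type*) [Field L] [CharZero L] : Subgroup Lˣ :=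
  (Units.map ((Rat.castHom L : ℚ →+* L) : ℚ →* L)).range ⊔ integralUnits L

lemma mem_rationalTimesUnits_iff {L : Type*} [Field L] [CharZero L] {y : Lˣ} :
    y ∈ rationalTimesUnits L ↔ ∃ (r : ℚˣ) (u : (𝓞 L)ˣ), (y : L) = (r : ℚ) * ((u : 𝓞 L) : L) := by
  rw [rationalTimesUnits, Subgroup.mem_sup]
  constructor
  · rintro ⟨_, ⟨r, rfl⟩, _, ⟨u, rfl⟩, rfl⟩
    exact ⟨r, u, rfl⟩
  · rintro ⟨r, u, h⟩
    exact ⟨_, ⟨r, rfl⟩, _, ⟨u, rfl⟩, Units.ext h.symm⟩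

lemma map_apply_mem_integralUnits (σ : K ≃ₐ[ℚ] K) {x : Kˣ} (hx : x ∈ integralUnits K) :
    Units.map (σ : K →* K) x ∈ integralUnits K :=
  (map_mem_integralUnits_iff (σ : K →+* K)).mpr hx

lemma integralUnits_le_ambiguousElements (σ : K ≃ₐ[ℚ] K) :
    integralUnits K ≤ ambiguousElements σ := fun _ hx =>
  div_mem (map_apply_mem_integralUnits σ hx) hx

variable {σ : K ≃ₐ[ℚ] K}

lemma map_map_div_mem_integralUnits {x : Kˣ} (hx : x ∈ ambiguousElements σ) :
    Units.map (σ : K →* K) (Units.map (σ : K →* K) x) / x ∈ integralUnits K := by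
  have h := mul_mem (map_apply_mem_integralUnits σ hx) (mem_ambiguousElements.mp hx)
  rwa [quotHom_apply, map_div, div_mul_div_cancel] at h

lemma map_div_mem_integralUnits (hK : Module.finrank F K = 3)
    (hfix : ∀ x ∈ F, σ x = x) (hσ : σ ≠ 1) {g : K ≃ₐ[ℚ] K} (hg : ∀ x ∈ F, g x = x) {x : Kˣ}
    (hx : x ∈ ambiguousElements σ) : Units.map (g : K →* K) x / x ∈ integralUnits K := by
  rcases eq_of_cubic hK hfix hσ hg with h | h | h
  · have : Units.map (g : K →* K) x = x := Units.ext (h x)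
    rw [this, div_self']
    exact one_mem _
  · have : Units.map (g : K →* K) x = Units.map (σ : K →* K) x := Units.ext (h x)
    rw [this]
    exact hx
  · have : Units.map (g : K →* K) x = Units.map (σ : K →* K) (Units.map (σ : K →* K) x) :=
      Units.ext (h x)
    rw [this]
    exact map_map_div_mem_integralUnits hx

lemma conj_fixes (hF : Module.finrank ℚ F = 2) (hfix : ∀ x ∈ F, σ x = x) {τ : K ≃ₐ[ℚ] K}
    (hτ : ∀ x, τ (τ x) = x) : ∀ x ∈ F, (τ * σ * τ) x = x := fun x hx => by
  rw [AlgEquiv.mul_apply, AlgEquiv.mul_apply,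
    hfix (τ x) (map_mem_of_finrank_eq_two hF (τ : K →ₐ[ℚ] K) hx), hτ]

lemma map_norm_mem_ambiguousElements (hF : Module.finrank ℚ F = 2) (hK : Module.finrank F K = 3)
    (hK' : Module.finrank L K = 2) (hfix : ∀ x ∈ F, σ x = x) (hσ : σ ≠ 1) {x : Kˣ}
    (hx : x ∈ ambiguousElements σ) :
    Units.map (algebraMap L K : L →* K) (Units.map (Algebra.norm L) x) ∈ ambiguousElements σ := by
  obtain ⟨τ, -, hτ, -, hnorm⟩ := exists_quadratic_automorphism hK'
  have h1 : Units.map (algebraMap L K : L →* K) (Units.map (Algebra.norm L) x) =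
      x * Units.map (τ : K →* K) x := Units.ext (hnorm x)
  rw [h1]
  refine mul_mem hx ?_
  have h2 := map_apply_mem_integralUnits τ
    (map_div_mem_integralUnits hK hfix hσ (conj_fixes hF hfix hτ) hx)
  rw [mem_ambiguousElements]
  convert h2 using 1
  rw [map_div]
  congr 1
  exact Units.ext (hτ _).symm

lemma norm_mem_rationalTimesUnits (hF : Module.finrank ℚ F = 2) (hL : Module.finrank ℚ L = 3)
    (hK' : Module.finrank L K = 2) {x : Kˣ} (hx : (x : K) ∈ F) :
    Units.map (Algebra.norm L) x ∈ rationalTimesUnits L := by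
  obtain ⟨τ, -, -, -, hnorm⟩ := exists_quadratic_automorphism hK'
  obtain ⟨r, hr⟩ := exists_rat_of_mem_of_mem hF hL (x := (Algebra.norm L (x : K) : K))
    (by
      rw [hnorm]
      exact mul_mem hx (map_mem_of_finrank_eq_two hF (τ : K →ₐ[ℚ] K) hx))
    (Algebra.norm L (x : K)).2
  have hr' : (r : L) = Algebra.norm L (x : K) := Subtype.ext (by simpa using hr)
  have hr0 : r ≠ 0 := by
    rintro rfl
    exact (Units.map (Algebra.norm L) x).ne_zero (by simpa using hr'.symm)
  exact Subgroup.mem_sup_left ⟨Units.mk0 r hr0, Units.ext hr'⟩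

lemma exists_rat_eq_norm (hF : Module.finrank ℚ F = 2) (hL : Module.finrank ℚ L = 3)
    (hK : Module.finrank F K = 3) (hK' : Module.finrank L K = 2) (hfix : ∀ x ∈ F, σ x = x)
    (hσ : σ ≠ 1) {x : K} (hx : x ∈ L) : ∃ r : ℚ, (r : K) = x * σ x * σ (σ x) := by
  obtain ⟨τ, -, hτ, hτL, -⟩ := exists_quadratic_automorphism hK'
  have h3 := apply_apply_apply_of_cubic hK hfix hσ
  refine exists_rat_of_mem_of_mem hF hL ?_ ?_
  · rw [← apply_eq_self_iff_of_cubic hK hfix hσ, map_mul, map_mul, h3]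
    ring
  · have hx' := (hτL x).mpr hx
    have h1 : τ (σ x) = (τ * σ * τ) x := by
      rw [AlgEquiv.mul_apply, AlgEquiv.mul_apply, hx']
    have h2 : τ (σ (σ x)) = (τ * σ * τ) ((τ * σ * τ) x) := by
      simp only [AlgEquiv.mul_apply, hx', hτ]
    rw [← hτL, map_mul, map_mul, hx', h1, h2]
    rcases eq_of_cubic hK hfix hσ (conj_fixes hF hfix hτ) with h | h | h
    · refine absurd (AlgEquiv.ext fun z => ?_) hσ
      have h4 := congrArg τ (h (τ z))
      rwa [AlgEquiv.mul_apply, AlgEquiv.mul_apply, hτ, hτ] at h4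
    · rw [h, h]
    · rw [h, h, h3]
      ring

lemma mem_map_norm_sup_rationalTimesUnits (hF : Module.finrank ℚ F = 2)
    (hL : Module.finrank ℚ L = 3) (hK : Module.finrank F K = 3) (hK' : Module.finrank L K = 2)
    (hfix : ∀ x ∈ F, σ x = x) (hσ : σ ≠ 1) {y : Lˣ}
    (hy : Units.map (algebraMap L K : L →* K) y ∈ ambiguousElements σ) :
    y ∈ (ambiguousElements σ).map (Units.map (Algebra.norm L)) ⊔ rationalTimesUnits L := by
  set x := Units.map (algebraMap L K : L →* K) y with hxdef
  have hnorm : Units.map (Algebra.norm L) x = y ^ 2 :=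
    Units.ext ((Algebra.norm_algebraMap (y : L)).trans (by rw [hK']; rfl))
  obtain ⟨r, hr⟩ := exists_rat_eq_norm hF hL hK hK' hfix hσ (y : L).2
  have hr0 : r ≠ 0 := by
    rintro rfl
    have : (x : K) * σ x * σ (σ x) = 0 := by simpa using hr.symm
    simp at this
  let q : Lˣ := Units.map ((Rat.castHom L : ℚ →+* L) : ℚ →* L) (Units.mk0 r hr0)
  have hq : Units.map (algebraMap L K : L →* K) q =
      x * Units.map (σ : K →* K) x * Units.map (σ : K →* K) (Units.map (σ : K →* K) x) := by
    refine Units.ext (Eq.trans ?_ hr)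
    simp [q]
  have hv : q / y ^ 3 ∈ integralUnits L := by
    rw [← map_mem_integralUnits_iff (algebraMap L K)]
    have h := mul_mem (mem_ambiguousElements.mp hy) (map_map_div_mem_integralUnits hy)
    convert h using 1
    rw [map_div, map_pow]
    erw [hq]
    rw [div_mul_div_comm, mul_assoc, pow_succ, pow_two, mul_assoc, mul_div_mul_left_eq_div]
  have hyq : y = Units.map (Algebra.norm L) (x ^ 2) * (q / (q / y ^ 3))⁻¹ := by
    rw [map_pow, hnorm, div_div_cancel, ← pow_mul]
    exact eq_mul_inv_of_mul_eq (by rw [← pow_succ'])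
  rw [hyq]
  exact Subgroup.mul_mem_sup (Subgroup.mem_map_of_mem _ (pow_mem hy 2))
    (inv_mem (div_mem (Subgroup.mem_sup_left ⟨_, rfl⟩) (Subgroup.mem_sup_right hv)))

lemma rationalTimesUnits_le (σ : K ≃ₐ[ℚ] K) :
    rationalTimesUnits L ≤
      (ambiguousElements σ).comap (Units.map (algebraMap L K : L →* K)) := by
  refine sup_le ?_ fun u hu => ?_
  · rintro _ ⟨r, rfl⟩
    rw [Subgroup.mem_comap, mem_ambiguousElements]
    convert one_mem (integralUnits K)
    rw [div_eq_one]
    ext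
    simp
  · exact integralUnits_le_ambiguousElements σ ((map_mem_integralUnits_iff (algebraMap L K)).mpr hu)

lemma relIndex_ambiguousElements_eq_mul (hF : Module.finrank ℚ F = 2)
    (hL : Module.finrank ℚ L = 3) (hK : Module.finrank F K = 3) (hK' : Module.finrank L K = 2)
    (hfix : ∀ x ∈ F, σ x = x) (hσ : σ ≠ 1) :
    ((quotHom (Units.map (σ : K →* K))).ker ⊔ integralUnits K).relIndex (ambiguousElements σ) =
      (rationalTimesUnits L).relIndex
          ((ambiguousElements σ).comap (Units.map (algebraMap L K : L →* K))) *
        ((quotHom (Units.map (σ : K →* K))).ker ⊔ integralUnits K).relIndex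
          (ambiguousElements σ ⊓ (rationalTimesUnits L).comap (Units.map (Algebra.norm L))) := by
  have hle : (quotHom (Units.map (σ : K →* K))).ker ⊔ integralUnits K ≤
      ambiguousElements σ ⊓ (rationalTimesUnits L).comap (Units.map (Algebra.norm L)) := by
    refine sup_le (le_inf (fun x hx => ?_) fun x hx => ?_) (le_inf
      (integralUnits_le_ambiguousElements σ) fun x hx =>
        Subgroup.mem_sup_right (map_norm_mem_integralUnits hx))
    · rw [ambiguousElements, Subgroup.mem_comap, MonoidHom.mem_ker.mp hx]
      exact one_mem _
    · refine norm_mem_rationalTimesUnits hF hL hK' ?_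
      rw [← apply_eq_self_iff_of_cubic hK hfix hσ]
      exact congrArg Units.val (mem_ker_quotHom.mp hx)
  rw [← Subgroup.relIndex_mul_relIndex _ _ _ hle inf_le_left, mul_comm, inf_comm,
    Subgroup.inf_relIndex_right, Subgroup.relIndex_comap]
  congr 1
  rw [← Subgroup.relIndex_sup_right]
  congr 1
  refine le_antisymm (sup_le ?_ (rationalTimesUnits_le σ)) fun y hy =>
    mem_map_norm_sup_rationalTimesUnits hF hL hK hK' hfix hσ hy
  rintro _ ⟨x, hx, rfl⟩
  exact map_norm_mem_ambiguousElements hF hK hK' hfix hσ hx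

end AmbiguousNorm

section Ideals

variable {K : Type*} [Field K] [NumberField K]

lemma relIndex_map_toPrincipalIdeal {H X : Subgroup Kˣ} (hX : integralUnits K ≤ X) :
    (H.map (toPrincipalIdeal (𝓞 K) K)).relIndex (X.map (toPrincipalIdeal (𝓞 K) K)) =
      (H ⊔ integralUnits K).relIndex X := by
  rw [Subgroup.relIndex_map_map, ker_toPrincipalIdeal, sup_eq_left.mpr hX]

end Ideals

section PureCubic

variable (d : ℕ)

lemma zetaK_isPrimitiveRoot : IsPrimitiveRoot (zetaK d) 3 :=
  IsPrimitiveRoot.of_map_of_injective (f := (Kc d).val) zeta3_isPrimitiveRoot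
    (Kc d).val.injective

lemma cbrtK_pow_three : cbrtK d ^ 3 = d := Subtype.ext (cbrt_pow_three d)

lemma LS_sup_k0S : LS d ⊔ k0S d = ⊤ := by
  rw [eq_top_iff]
  rintro ⟨x, hx⟩ -
  refine IntermediateField.adjoin_induction ℚ
    (p := fun x hx => (⟨x, hx⟩ : Kc d) ∈ LS d ⊔ k0S d) ?_ ?_ ?_ ?_ ?_ hx
  · rintro y (rfl | rfl)
    · exact le_sup_left (a := LS d) (IntermediateField.mem_adjoin_simple_self ℚ (cbrtK d))
    · exact le_sup_right (a := LS d) (IntermediateField.mem_adjoin_simple_self ℚ (zetaK d))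
  · intro r
    have h : (r : Kc d) ∈ LS d ⊔ k0S d := SubfieldClass.ratCast_mem _ r
    convert h
    exact Subtype.ext ((eq_ratCast (algebraMap ℚ ℂ) r).trans (map_ratCast (Kc d).val r).symm)
  · intro x y hx hy h1 h2
    exact add_mem h1 h2
  · intro x hx h1
    exact inv_mem h1
  · intro x y hx hy h1 h2
    exact mul_mem h1 h2

lemma finrank_k0S : Module.finrank ℚ (k0S d) = 2 :=
  finrank_adjoin_primitiveRoot_three (zetaK_isPrimitiveRoot d)

lemma finrank_LS {d : ℕ} (hd : 1 < d) (h : IsCubeFree d) : Module.finrank ℚ (LS d) = 3 :=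
  finrank_adjoin_cubeRoot hd h (cbrtK_pow_three d)

lemma unitNormSubgroup_eq : unitNormSubgroup d =
    (Units.map (RingOfIntegers.norm (k0S d) : 𝓞 (Kc d) →* 𝓞 (k0S d))).range := by
  rw [MonoidHom.range_eq_map]
  refine closure_eq_map _ _ fun u => ?_
  simp only [Set.mem_ofPred_eq, Subgroup.mem_top, true_and]
  refine exists_congr fun v => ⟨fun h => units_ringOfIntegers_ext h, fun h => ?_⟩
  rw [← h]
  rfl

variable (σ : Kc d ≃ₐ[ℚ] Kc d)

lemma mem_ambiguousElements_iff_span {x : (Kc d)ˣ} :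
    FractionalIdeal.spanSingleton (𝓞 (Kc d))⁰ (σ (x : Kc d)) =
        FractionalIdeal.spanSingleton (𝓞 (Kc d))⁰ (x : Kc d) ↔ x ∈ ambiguousElements σ :=
  spanSingleton_eq_spanSingleton_iff_div_mem (y := Units.map (σ : Kc d →* Kc d) x)

lemma ambPrincipalK_eq :
    ambPrincipalK d σ = (ambiguousElements σ).map (toPrincipalIdeal (𝓞 (Kc d)) (Kc d)) := by
  refine closure_eq_map _ _ fun I => exists_congr fun x => ?_
  rw [mem_ambiguousElements_iff_span, and_comm, eq_comm]

lemma ambPrincipalL_eq :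
    ambPrincipalL d σ = ((ambiguousElements σ).comap
      (Units.map (algebraMap (LS d) (Kc d) : LS d →* Kc d))).map
        (toPrincipalIdeal (𝓞 (LS d)) (LS d)) := by
  refine closure_eq_map _ _ fun I => exists_congr fun x => ?_
  rw [Subgroup.mem_comap, ← mem_ambiguousElements_iff_span, and_comm,
    eq_comm (a := toPrincipalIdeal (𝓞 (LS d)) (LS d) x)]
  rfl

lemma principalFromQ_eq :
    principalFromQ d = (Units.map ((Rat.castHom (LS d) : ℚ →+* LS d) : ℚ →* LS d)).range.map
      (toPrincipalIdeal (𝓞 (LS d)) (LS d)) := by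
  have h : ∀ r : ℚˣ, Units.map (algebraMap ℚ (LS d)).toMonoidHom r =
      Units.map ((Rat.castHom (LS d) : ℚ →+* LS d) : ℚ →* LS d) r :=
    fun r => Units.ext (by simp)
  refine closure_eq_map _ _ fun I => ?_
  simp only [Set.mem_ofPred_eq, MonoidHom.mem_range, exists_exists_eq_and]
  refine exists_congr fun r => ?_
  rw [h, eq_comm]

lemma principalFromK0_eq {d : ℕ} {σ : Kc d ≃ₐ[ℚ] Kc d} (hK : Module.finrank (k0S d) (Kc d) = 3)
    (hfix : ∀ x ∈ k0S d, σ x = x) (hσ : σ ≠ 1) :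
    principalFromK0 d = (quotHom (Units.map (σ : Kc d →* Kc d))).ker.map
      (toPrincipalIdeal (𝓞 (Kc d)) (Kc d)) := by
  refine closure_eq_map _ _ fun I => exists_congr fun x => ?_
  rw [mem_ker_quotHom, eq_comm (a := I), Units.ext_iff (u := Units.map _ _)]
  exact and_congr_left' (apply_eq_self_iff_of_cubic hK hfix hσ).symm

lemma relPrincipalFactors_eq :
    relPrincipalFactors d σ = ((((ambiguousElements σ ⊓
      (rationalTimesUnits (LS d)).comap (Units.map (Algebra.norm (LS d)))).map
        (toPrincipalIdeal (𝓞 (Kc d)) (Kc d))).subgroupOf (ambPrincipalK d σ)).map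
          (QuotientGroup.mk' ((principalFromK0 d).subgroupOf (ambPrincipalK d σ)))) := by
  refine closure_eq_map _ _ fun c => ?_
  constructor
  · rintro ⟨x, h, rfl, r, u, hru⟩
    refine ⟨_, ⟨x, ⟨(mem_ambiguousElements_iff_span d σ).mp h,
      mem_rationalTimesUnits_iff.mpr ⟨r, u, ?_⟩⟩, rfl⟩, rfl⟩
    rw [eq_ratCast] at hru
    exact hru
  · rintro ⟨⟨_, hA⟩, ⟨x, ⟨hx, hx'⟩, rfl⟩, rfl⟩
    obtain ⟨r, u, hru⟩ := mem_rationalTimesUnits_iff.mp hx'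
    refine ⟨x, (mem_ambiguousElements_iff_span d σ).mpr hx, rfl, r, u, ?_⟩
    rw [eq_ratCast]
    exact hru

end PureCubic

/-- Equation (3): the group `𝒫_k^G/𝒫_{k₀}` of primitive ambiguous principal ideals of `k/k₀`
has order `3^{U+1} = 3·(E_{k₀} : N_{k/k₀}(E_k))`, and this order also equals
`3^{A+R} = #(𝒫_L^G/𝒫_ℚ) · #(ker(𝒫_k^G/𝒫_{k₀} → 𝓘_L^G/𝓘_ℚ))`. -/
theorem card_primitive_ambiguous_principal_ideals
    (d : ℕ) (hd : 1 < d) (hdcf : IsCubeFree d)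
    (σ : ↥(Kc d) ≃ₐ[ℚ] ↥(Kc d)) (hσfix : ∀ x : ↥(Kc d), x ∈ k0S d → σ x = x)
    (hσne : σ ≠ 1) :
    Nat.card (ambPrincipalQuot d σ) = 3 * unitNormIndex d ∧
    Nat.card (ambPrincipalQuot d σ) =
      Nat.card (absPrincipalFactors d σ) * Nat.card ↥(relPrincipalFactors d σ) := by
  have hF := finrank_k0S d
  have hL := finrank_LS hd hdcf
  have hK6 := finrank_eq_six hF hL (LS_sup_k0S d)
  have hK := finrank_eq_three hF hK6
  have hK' := finrank_eq_two hL hK6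
  have hle := integralUnits_le_ambiguousElements σ
  have hleL : integralUnits (LS d) ≤
      (ambiguousElements σ).comap (Units.map (algebraMap (LS d) (Kc d) : LS d →* Kc d)) :=
    le_sup_right.trans (rationalTimesUnits_le σ)
  have hleR : integralUnits (Kc d) ≤ ambiguousElements σ ⊓
      (rationalTimesUnits (LS d)).comap (Units.map (Algebra.norm (LS d))) :=
    le_inf hle fun x hx => Subgroup.mem_sup_right (map_norm_mem_integralUnits hx)
  have hamb : Nat.card (ambPrincipalQuot d σ) =
      ((quotHom (Units.map (σ : Kc d →* Kc d))).ker ⊔ integralUnits (Kc d)).relIndex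
        (ambiguousElements σ) := by
    rw [← relIndex_map_toPrincipalIdeal hle, ← principalFromK0_eq hK hσfix hσne,
      ← ambPrincipalK_eq]
    rfl
  have habs : Nat.card (absPrincipalFactors d σ) = (rationalTimesUnits (LS d)).relIndex
      ((ambiguousElements σ).comap (Units.map (algebraMap (LS d) (Kc d) : LS d →* Kc d))) := by
    rw [rationalTimesUnits, ← relIndex_map_toPrincipalIdeal hleL, ← principalFromQ_eq,
      ← ambPrincipalL_eq]
    rfl
  have hrel : Nat.card (relPrincipalFactors d σ) =
      ((quotHom (Units.map (σ : Kc d →* Kc d))).ker ⊔ integralUnits (Kc d)).relIndex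
        (ambiguousElements σ ⊓
          (rationalTimesUnits (LS d)).comap (Units.map (Algebra.norm (LS d)))) := by
    rw [← relIndex_map_toPrincipalIdeal hleR, ← principalFromK0_eq hK hσfix hσne,
      relPrincipalFactors_eq]
    refine card_map_mk_subgroupOf ?_
    rw [ambPrincipalK_eq]
    exact Subgroup.map_mono inf_le_left
  refine ⟨?_, ?_⟩
  · rw [hamb, unitNormIndex, unitNormSubgroup_eq]
    exact relIndex_ambiguous_eq hF (zetaK_isPrimitiveRoot d)
      (IntermediateField.mem_adjoin_simple_self ℚ _) hK hσfix hσne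
  · rw [hamb, habs, hrel]
    exact relIndex_ambiguousElements_eq_mul hF hL hK hK' hσfix hσne

end
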